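/- An Archimedean vector lattice F is atomic (every g > 0 dominates an atom) if and only if unbounded order (uo) convergence on F is topological, i.e., there exists a topology τ on F such that for every filter G on F and every f ∈ F, G uo-converges to f if and only if G contains the τ-neighborhood filter of f. -/

import Mathlib

/-- A filter `G` on a lattice order converges to `p` if it contains a family of
order intervals whose intersection equals `{p}`. -/
def OrderConvergesTo {F : Type*} [Lattice F] (G : Filter F) (p : F) : Prop :=
  ∃ S : Set (F × F),
    (∀ q ∈ S, q.1 ≤ q.2) ∧
    (∀ q ∈ S, Set.Icc q.1 q.2 ∈ G) ∧
    (⋂ q ∈ S, Set.Icc q.1 q.2) = {p}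

/-- A filter `G` is order Cauchy if the pushforward of `G ×ˢ G` under `(x, y) ↦ x - y`
order converges to `0`. -/
def OrderCauchy {F : Type*} [Lattice F] [AddCommGroup F] (G : Filter F) : Prop :=
  OrderConvergesTo (Filter.map (fun q : F × F => q.1 - q.2) (G ×ˢ G)) (0 : F)

/-- A subset `S` is order pre-compact if every ultrafilter containing `S` is order Cauchy. -/
def OrderPreCompact {F : Type*} [Lattice F] [AddCommGroup F] (S : Set F) : Prop :=
  ∀ U : Ultrafilter F, S ∈ U → OrderCauchy (U : Filter F)

/-- An atom of a vector lattice: a positive element all of whose order-subelements are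
scalar multiples of it. -/
def IsVLAtom {F : Type*} [Lattice F] [AddCommGroup F] [Module ℝ F] (a : F) : Prop :=
  0 < a ∧ ∀ b : F, 0 ≤ b → b ≤ a → ∃ t : ℝ, b = t • a

/-- A filter `G` uo-converges to `f` if for every `h ≥ 0` the pushforward of `G` under
`x ↦ |x - f| ⊓ h` order converges to `0`. -/
def UoConvergesTo {F : Type*} [Lattice F] [AddCommGroup F] (G : Filter F) (f : F) : Prop :=
  ∀ h : F, 0 ≤ h →
    OrderConvergesTo (Filter.map (fun x : F => |x - f| ⊓ h) G) (0 : F)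

section VectorLattice

variable {F : Type*} [Lattice F] [AddCommGroup F]

theorem inf_add_le_inf_add_inf [IsOrderedAddMonoid F] {a b c : F} (ha : 0 ≤ a) (hb : 0 ≤ b)
    (hc : 0 ≤ c) : (a + b) ⊓ c ≤ a ⊓ c + b ⊓ c := by
  rw [inf_add, add_inf, add_inf]
  refine le_inf (le_inf inf_le_left ?_) (le_inf ?_ ?_)
  · exact inf_le_right.trans (le_add_of_nonneg_left ha)
  · exact inf_le_right.trans (le_add_of_nonneg_right hb)
  · exact inf_le_right.trans (le_add_of_nonneg_right hc)

theorem nsmul_inf_eq_zero [IsOrderedAddMonoid F] {a b : F} (ha : 0 ≤ a) (hb : 0 ≤ b)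
    (h : a ⊓ b = 0) (n : ℕ) : (n • a) ⊓ b = 0 := by
  induction n with
  | zero => simpa using hb
  | succ n ih =>
    refine le_antisymm ?_ (le_inf (nsmul_nonneg ha _) hb)
    rw [succ_nsmul]
    refine (inf_add_le_inf_add_inf (nsmul_nonneg ha n) ha hb).trans ?_
    rw [ih, h, add_zero]

theorem add_le_of_inf_eq_zero [IsOrderedAddMonoid F] {a b c : F} (h : a ⊓ b = 0)
    (ha : a ≤ c) (hb : b ≤ c) : a + b ≤ c := by
  rw [← inf_add_sup, h, zero_add]
  exact sup_le ha hb

theorem uoConvergesTo_iff [IsOrderedAddMonoid F] {G : Filter F} {f : F} :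
    UoConvergesTo G f ↔ ∀ h : F, 0 ≤ h →
      ∃ V : Set F, (∀ v ∈ V, ∀ᶠ x in G, |x - f| ⊓ h ≤ v) ∧ IsGLB V 0 := by
  refine forall₂_congr fun h hh => ⟨?_, ?_⟩
  · rintro ⟨S, -, hG, hS⟩
    have h0 : (0 : F) ∈ ⋂ q ∈ S, Set.Icc q.1 q.2 := by rw [hS]; rfl
    simp only [Set.mem_iInter, Set.mem_Icc] at h0
    refine ⟨Prod.snd '' S, ?_, ?_, ?_⟩
    · rintro _ ⟨q, hq, rfl⟩
      exact Filter.mem_of_superset (Filter.mem_map.1 (hG q hq)) fun x hx => hx.2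
    · rintro _ ⟨q, hq, rfl⟩
      exact (h0 q hq).2
    · intro w hw
      have hmem : w ⊔ 0 ∈ ⋂ q ∈ S, Set.Icc q.1 q.2 := by
        simp only [Set.mem_iInter, Set.mem_Icc]
        exact fun q hq => ⟨(h0 q hq).1.trans le_sup_right,
          sup_le (hw ⟨q, hq, rfl⟩) (h0 q hq).2⟩
      rw [hS] at hmem
      exact sup_eq_right.1 hmem
  · rintro ⟨V, hV, hglb⟩
    refine ⟨(fun v => ((0 : F), v)) '' V, ?_, ?_, ?_⟩
    · rintro _ ⟨v, hv, rfl⟩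
      exact hglb.1 hv
    · rintro _ ⟨v, hv, rfl⟩
      exact Filter.mem_map.2 (Filter.mem_of_superset (hV v hv) fun x hx =>
        ⟨le_inf (abs_nonneg _) hh, hx⟩)
    · ext w
      simp only [Set.mem_iInter, Set.forall_mem_image, Set.mem_Icc, Set.mem_singleton_iff]
      constructor
      · intro hw
        rcases V.eq_empty_or_nonempty with rfl | ⟨v, hv⟩
        · have htop : ∀ z : F, z ≤ 0 := fun z => hglb.2 (by simp)
          exact le_antisymm (htop w) (by simpa using htop (-w))
        · exact le_antisymm (hglb.2 fun v hv => (hw hv).2) (hw hv).1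
      · rintro rfl v hv
        exact ⟨le_rfl, hglb.1 hv⟩

theorem exists_disjoint_of_not_isVLAtom [IsOrderedAddMonoid F] [Module ℝ F] [IsOrderedModule ℝ F]
    (harch : ∀ x y : F, (∀ n : ℕ, 0 ≤ n • x ∧ n • x ≤ y) → x = 0)
    {w : F} (hw : 0 < w) (hna : ¬ IsVLAtom w) :
    ∃ p q : F, 0 < p ∧ 0 < q ∧ p ≤ w ∧ q ≤ w ∧ p ⊓ q = 0 := by
  by_contra! hcon
  refine hna ⟨hw, fun b hb0 hbw => ?_⟩
  have hcmp : ∀ t : ℝ, 0 ≤ t → t ≤ 1 → t • w ≤ b ∨ b ≤ t • w := by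
    intro t ht0 ht1
    have htw : t • w ≤ w := by simpa using smul_le_smul_of_nonneg_right ht1 hw.le
    by_contra! hne
    refine hcon (b - t • w)⁺ (b - t • w)⁻ ?_ ?_ ?_ ?_ (posPart_inf_negPart_eq_zero _)
    · refine lt_of_le_of_ne (posPart_nonneg _) fun h => hne.2 ?_
      simpa using posPart_eq_zero.1 h.symm
    · refine lt_of_le_of_ne (negPart_nonneg _) fun h => hne.1 ?_
      simpa using negPart_eq_zero.1 h.symm
    · exact sup_le ((sub_le_self _ (smul_nonneg ht0 hw.le)).trans hbw) hw.le
    · refine sup_le ?_ hw.le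
      rw [neg_sub]
      exact (sub_le_self _ hb0).trans htw
  set T : Set ℝ := {t | 0 ≤ t ∧ t ≤ 1 ∧ t • w ≤ b} with hT
  have hT0 : (0 : ℝ) ∈ T := ⟨le_rfl, zero_le_one, by simpa using hb0⟩
  have hTb : BddAbove T := ⟨1, fun t ht => ht.2.1⟩
  have hs0 : 0 ≤ sSup T := le_csSup hTb hT0
  have hlow : ∀ r, r < sSup T → r • w ≤ b := by
    intro r hr
    obtain ⟨t, ht, hrt⟩ := exists_lt_of_lt_csSup ⟨0, hT0⟩ hr
    exact (smul_le_smul_of_nonneg_right hrt.le hw.le).trans ht.2.2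
  have hupp : ∀ r, sSup T < r → b ≤ r • w := by
    intro r hr
    rcases le_total r 1 with h1 | h1
    · refine (hcmp r (hs0.trans hr.le) h1).resolve_left fun h => ?_
      exact hr.not_ge (le_csSup hTb ⟨hs0.trans hr.le, h1, h⟩)
    · exact hbw.trans (by simpa using smul_le_smul_of_nonneg_right h1 hw.le)
  suffices h : |b - sSup T • w| = 0 from
    ⟨sSup T, sub_eq_zero.1 (le_antisymm ((le_abs_self _).trans h.le)
      (neg_nonpos.1 ((neg_le_abs _).trans h.le)))⟩
  refine harch _ w fun n => ?_
  refine ⟨nsmul_nonneg (abs_nonneg _) n, ?_⟩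
  rcases Nat.eq_zero_or_pos n with rfl | hn
  · simpa using hw.le
  have hn' : (0 : ℝ) < n := Nat.cast_pos.2 hn
  have hε : (0 : ℝ) < (n : ℝ)⁻¹ := inv_pos.2 hn'
  have habs : |b - sSup T • w| ≤ (n : ℝ)⁻¹ • w := by
    refine abs_le'.2 ⟨?_, ?_⟩
    · rw [sub_le_iff_le_add, ← add_smul]
      exact hupp _ (by linarith)
    · rw [neg_sub, sub_le_comm, ← sub_smul]
      exact hlow _ (by linarith)
  calc n • |b - sSup T • w| ≤ n • ((n : ℝ)⁻¹ • w) := nsmul_le_nsmul_right habs n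
    _ = w := by rw [← Nat.cast_smul_eq_nsmul ℝ, smul_smul, mul_inv_cancel₀ hn'.ne', one_smul]

theorem IsVLAtom.exists_inf_eq_smul [IsOrderedAddMonoid F] [Module ℝ F] {a x : F}
    (ha : IsVLAtom a) (hx : 0 ≤ x) : ∃ t : ℝ, x ⊓ a = t • a :=
  ha.2 _ (le_inf hx ha.1.le) inf_le_right

theorem smul_le_smul_right_iff_of_pos_of_lattice [IsOrderedAddMonoid F] [Module ℝ F]
    [IsOrderedModule ℝ F]
    {a : F} (ha : 0 < a) {s t : ℝ} : s • a ≤ t • a ↔ s ≤ t := by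
  refine ⟨fun h => ?_, fun h => smul_le_smul_of_nonneg_right h ha.le⟩
  by_contra! hlt
  have h1 : (s - t) • a ≤ 0 := by rw [sub_smul]; exact sub_nonpos.2 h
  have h2 := smul_le_smul_of_nonneg_left h1 (inv_nonneg.2 (sub_pos.2 hlt).le)
  rw [smul_smul, inv_mul_cancel₀ (sub_pos.2 hlt).ne', one_smul, smul_zero] at h2
  exact ha.not_ge h2

theorem IsVLAtom.exists_topology [IsOrderedAddMonoid F] [Module ℝ F] [IsOrderedModule ℝ F]
    {a : F} (ha : IsVLAtom a) :
    ∃ τ : TopologicalSpace F, ∀ (G : Filter F) (f : F),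
      G ≤ @nhds F τ f ↔ ∀ ε : ℝ, 0 < ε → ∀ᶠ x in G, |x - f| ⊓ a ≤ ε • a := by
  choose d hd using fun x y : F => ha.exists_inf_eq_smul (abs_nonneg (x - y))
  let P : PseudoMetricSpace F :=
    { dist := d
      dist_self := fun x => by
        have h := hd x x
        rw [sub_self, abs_zero, inf_eq_left.2 ha.1.le] at h
        exact ((smul_eq_zero.1 h.symm).resolve_right ha.1.ne')
      dist_comm := fun x y => by
        refine smul_left_injective ℝ ha.1.ne' ?_
        change d x y • a = d y x • a
        rw [← hd, ← hd, abs_sub_comm]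
      dist_triangle := fun x y z => by
        rw [← smul_le_smul_right_iff_of_pos_of_lattice ha.1, add_smul, ← hd, ← hd, ← hd]
        have htri : |x - z| ≤ |x - y| + |y - z| := by
          simpa using abs_add_le (x - y) (y - z)
        refine (inf_le_inf_right a htri).trans ?_
        exact inf_add_le_inf_add_inf (abs_nonneg _) (abs_nonneg _) ha.1.le }
  refine ⟨P.toUniformSpace.toTopologicalSpace, fun G f => ?_⟩
  rw [Metric.nhds_basis_closedBall.ge_iff]
  refine forall₂_congr fun ε _ => ?_
  refine Filter.congr_sets (Filter.Eventually.of_forall fun x => ?_)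
  change d x f ≤ ε ↔ |x - f| ⊓ a ≤ ε • a
  rw [hd, smul_le_smul_right_iff_of_pos_of_lattice ha.1]

theorem exists_nsmul_le_not_succ_nsmul_le [IsOrderedAddMonoid F]
    (harch : ∀ x y : F, (∀ n : ℕ, 0 ≤ n • x ∧ n • x ≤ y) → x = 0)
    {b h : F} (hb : 0 < b) (hh : 0 ≤ h) : ∃ n : ℕ, n • b ≤ h ∧ ¬ (n + 1) • b ≤ h := by
  by_contra! hcon
  refine hb.ne' (harch b h fun n => ⟨nsmul_nonneg hb.le n, ?_⟩)
  induction n with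
  | zero => simpa using hh
  | succ n ih => exact hcon n ih

theorem IsVLAtom.sub_inf_inf_eq_zero [IsOrderedAddMonoid F] [Module ℝ F] [IsOrderedModule ℝ F]
    {a y : F} (ha : IsVLAtom a) (hy : 0 ≤ y) {ε : ℝ} (hε : ε < 1) (hya : y ⊓ a ≤ ε • a) :
    (y - y ⊓ a) ⊓ a = 0 := by
  obtain ⟨r, hr⟩ := ha.exists_inf_eq_smul hy
  have hu : 0 ≤ y - y ⊓ a := sub_nonneg.2 inf_le_left
  obtain ⟨s, hs⟩ := ha.exists_inf_eq_smul hu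
  have hs0 : 0 ≤ (y - y ⊓ a) ⊓ a := le_inf hu ha.1.le
  refine le_antisymm ?_ hs0
  have hrε : r ≤ ε := (smul_le_smul_right_iff_of_pos_of_lattice ha.1).1 (hr ▸ hya)
  have hsr : (s + r) • a ≤ y := by
    rw [add_smul, ← hs, ← hr]
    exact le_sub_iff_add_le.1 inf_le_left
  have hmin : min (s + r) 1 • a ≤ r • a := by
    rw [← hr]
    refine le_inf ((smul_le_smul_of_nonneg_right (min_le_left _ _) ha.1.le).trans hsr) ?_
    simpa using smul_le_smul_of_nonneg_right (min_le_right (s + r) 1) ha.1.le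
  have hle := (smul_le_smul_right_iff_of_pos_of_lattice ha.1).1 hmin
  have hs' : s ≤ 0 := by
    rcases min_le_iff.1 hle with h | h <;> linarith
  rw [hs]
  simpa using smul_le_smul_of_nonneg_right hs' ha.1.le

theorem uoConvergesTo_iff_of_atomic [IsOrderedAddMonoid F] [Module ℝ F] [IsOrderedModule ℝ F]
    (harch : ∀ x y : F, (∀ n : ℕ, 0 ≤ n • x ∧ n • x ≤ y) → x = 0)
    (hat : ∀ g : F, 0 < g → ∃ a : F, IsVLAtom a ∧ a ≤ g) {G : Filter F} {f : F} :
    UoConvergesTo G f ↔ ∀ a : F, IsVLAtom a → ∀ ε : ℝ, 0 < ε →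
      ∀ᶠ x in G, |x - f| ⊓ a ≤ ε • a := by
  rw [uoConvergesTo_iff]
  constructor
  · intro hG a ha ε hε
    obtain ⟨V, hV, hglb⟩ := hG a ha.1.le
    have hv : ∃ v ∈ V, v ⊓ a ≤ ε • a := by
      by_contra! hcon
      refine hε.not_ge ((smul_le_smul_right_iff_of_pos_of_lattice ha.1).1 ?_)
      rw [zero_smul]
      refine hglb.2 fun v hv => ?_
      obtain ⟨t, ht⟩ := ha.exists_inf_eq_smul (hglb.1 hv)
      have hlt := hcon v hv
      rw [ht, smul_le_smul_right_iff_of_pos_of_lattice ha.1, not_le] at hlt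
      exact (smul_le_smul_of_nonneg_right hlt.le ha.1.le).trans (ht ▸ inf_le_left)
    obtain ⟨v, hvV, hva⟩ := hv
    exact (hV v hvV).mono fun x hx => (le_inf hx inf_le_right).trans hva
  · intro hG h hh
    refine ⟨{v | 0 ≤ v ∧ ∀ᶠ x in G, |x - f| ⊓ h ≤ v}, fun v hv => hv.2, fun v hv => hv.1, ?_⟩
    intro w hw
    by_contra hw0
    have hwp : 0 < w⁺ := lt_of_le_of_ne (posPart_nonneg _) fun h => hw0 (posPart_eq_zero.1 h.symm)
    obtain ⟨a, ha, haw⟩ := hat _ hwp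
    obtain ⟨b, rfl⟩ : ∃ b : F, a = (2 : ℕ) • b :=
      ⟨(2⁻¹ : ℝ) • a, by
        rw [← Nat.cast_smul_eq_nsmul ℝ, smul_smul, Nat.cast_ofNat,
          mul_inv_cancel₀ two_ne_zero, one_smul]⟩
    have hba : (2⁻¹ : ℝ) • (2 : ℕ) • b = b := by
      rw [← Nat.cast_smul_eq_nsmul ℝ, smul_smul, Nat.cast_ofNat,
          inv_mul_cancel₀ two_ne_zero, one_smul]
    have hb0 : 0 ≤ b := hba ▸ smul_nonneg (by norm_num) ha.1.le
    have hb : 0 < b := lt_of_le_of_ne hb0 (by rintro rfl; simpa using ha.1)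
    have hb2 : b ≤ (2 : ℕ) • b := by rw [two_nsmul]; exact le_add_of_nonneg_right hb0
    obtain ⟨n, hn, hn1⟩ := exists_nsmul_le_not_succ_nsmul_le harch hb hh
    have hv : h - n • b + b ∈ {v | 0 ≤ v ∧ ∀ᶠ x in G, |x - f| ⊓ h ≤ v} := by
      refine ⟨add_nonneg (sub_nonneg.2 hn) hb0, ?_⟩
      refine (hG _ ha 2⁻¹ (by norm_num)).mono fun x hx => ?_
      set y := |x - f| ⊓ h
      have hy : 0 ≤ y := le_inf (abs_nonneg _) hh
      have hya : y ⊓ (2 : ℕ) • b ≤ (2⁻¹ : ℝ) • (2 : ℕ) • b :=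
        (inf_le_inf_right _ inf_le_left).trans hx
      have hdis := ha.sub_inf_inf_eq_zero hy (by norm_num) hya
      rw [hba] at hya
      have hu : 0 ≤ y - y ⊓ (2 : ℕ) • b := sub_nonneg.2 inf_le_left
      have hdisb : b ⊓ (y - y ⊓ (2 : ℕ) • b) = 0 := by
        refine le_antisymm ?_ (le_inf hb0 hu)
        rw [inf_comm, ← hdis]
        exact inf_le_inf_left _ hb2
      have hsum : n • b + (y - y ⊓ (2 : ℕ) • b) ≤ h :=
        add_le_of_inf_eq_zero (nsmul_inf_eq_zero hb0 hu hdisb n) hn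
          ((sub_le_self _ (le_inf hy ha.1.le)).trans inf_le_right)
      calc y = (y - y ⊓ (2 : ℕ) • b) + y ⊓ (2 : ℕ) • b := (sub_add_cancel _ _).symm
        _ ≤ (h - n • b) + b := add_le_add (le_sub_iff_add_le'.2 hsum) hya
    have hav : (2 : ℕ) • b ≤ h - n • b + b := haw.trans (sup_le (hw hv) hv.1)
    rw [two_nsmul, add_le_add_iff_right, le_sub_iff_add_le'] at hav
    exact hn1 (by rwa [succ_nsmul])

/-- Every `e > 0` lies in a maximal inf-closed set of positive elements. -/
theorem exists_maximal_infClosed_pos {e : F} (he : 0 < e) :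
    ∃ S : Set F, e ∈ S ∧ (∀ u ∈ S, 0 < u) ∧ InfClosed S ∧
      ∀ w : F, (∀ u ∈ S, 0 < u ⊓ w) → e ⊓ w ∈ S := by
  have hchain : ∀ c ⊆ {S : Set F | (∀ u ∈ S, 0 < u) ∧ InfClosed S}, IsChain (· ⊆ ·) c →
      c.Nonempty → ∃ ub ∈ {S : Set F | (∀ u ∈ S, 0 < u) ∧ InfClosed S}, ∀ s ∈ c, s ⊆ ub := by
    intro c hc hchain _
    refine ⟨⋃₀ c, ⟨?_, ?_⟩, fun s hs => Set.subset_sUnion_of_mem hs⟩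
    · rintro u ⟨s, hs, hus⟩
      exact (hc hs).1 u hus
    · rintro u ⟨s, hs, hus⟩ v ⟨t, ht, hvt⟩
      rcases hchain.total hs ht with h | h
      · exact ⟨t, ht, (hc ht).2 (h hus) hvt⟩
      · exact ⟨s, hs, (hc hs).2 hus (h hvt)⟩
  obtain ⟨S, heS, hS⟩ := zorn_subset_nonempty _ hchain {e} ⟨by simpa using he, by simp⟩
  refine ⟨S, heS rfl, hS.prop.1, hS.prop.2, fun w hw => ?_⟩
  have hsub : S ⊆ S ∪ (· ⊓ w) '' S := Set.subset_union_left
  refine hS.le_of_ge ⟨?_, ?_⟩ hsub (Or.inr ⟨e, heS rfl, rfl⟩)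
  · rintro _ (hu | ⟨u, hu, rfl⟩)
    · exact hS.prop.1 _ hu
    · exact hw u hu
  · rintro _ (hu | ⟨u, hu, rfl⟩) _ (hv | ⟨v, hv, rfl⟩)
    · exact Or.inl (hS.prop.2 hu hv)
    · exact Or.inr ⟨_, hS.prop.2 hu hv, inf_assoc _ _ _⟩
    · exact Or.inr ⟨_, hS.prop.2 hu hv, inf_right_comm _ _ _⟩
    · exact Or.inr ⟨_, hS.prop.2 hu hv, inf_inf_distrib_right _ _ _⟩

/-- The elements of `[0, g]` dominated by a multiple of `u` but not by `v`. -/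
def notBelowSet (g v u : F) : Set F :=
  {x | 0 ≤ x ∧ x ≤ g ∧ (∃ n : ℕ, x ≤ n • u) ∧ ¬ x ≤ v}

theorem notBelowSet_mono [IsOrderedAddMonoid F] (g v : F) : Monotone (notBelowSet g v) :=
  fun _ _ huu' _ ⟨h0, hg, ⟨n, hn⟩, hv⟩ => ⟨h0, hg, ⟨n, hn.trans (nsmul_le_nsmul_right huu' n)⟩, hv⟩

theorem notBelowSet_nonempty [IsOrderedAddMonoid F]
    (harch : ∀ x y : F, (∀ n : ℕ, 0 ≤ n • x ∧ n • x ≤ y) → x = 0)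
    {g v u : F} (hg : 0 ≤ g) (hv : 0 ≤ v) (hu : 0 < u) (hug : u ≤ (g - v)⁺) :
    (notBelowSet g v u).Nonempty := by
  suffices ∃ n : ℕ, ¬ (n • u) ⊓ g ≤ v by
    obtain ⟨n, hn⟩ := this
    exact ⟨_, le_inf (nsmul_nonneg hu.le n) hg, inf_le_right, ⟨n, inf_le_left⟩, hn⟩
  by_contra! hcon
  refine hu.ne' (harch u v fun n => ⟨nsmul_nonneg hu.le n, ?_⟩)
  have hdis : ∀ n : ℕ, (n • u - v) ⊓ u ≤ 0 := by
    intro n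
    let := AddCommGroup.toDistribLattice F
    refine (inf_le_inf_left _ hug).trans ?_
    rw [posPart_def, inf_sup_left]
    refine sup_le ?_ inf_le_right
    rw [sub_eq_add_neg, sub_eq_add_neg, ← inf_add, ← sub_eq_add_neg, sub_nonpos]
    exact hcon n
  induction n with
  | zero => simpa using hv
  | succ n ih =>
    have h := hdis (n + 1)
    rw [succ_nsmul, add_sub_right_comm,
      inf_eq_left.2 (add_le_of_nonpos_left (sub_nonpos.2 ih))] at h
    rw [succ_nsmul]
    rwa [← add_sub_right_comm, sub_nonpos] at h

theorem exists_uoConvergesTo_zero_not_eventually_le [IsOrderedAddMonoid F] [Module ℝ F]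
    [IsOrderedModule ℝ F]
    (harch : ∀ x y : F, (∀ n : ℕ, 0 ≤ n • x ∧ n • x ≤ y) → x = 0)
    {g v : F} (hg : 0 < g) (hna : ∀ a : F, IsVLAtom a → ¬ a ≤ g) (hv : 0 ≤ v) (hgv : ¬ g ≤ v) :
    ∃ G : Filter F, UoConvergesTo G 0 ∧ ¬ ∀ᶠ x in G, |x| ⊓ g ≤ v := by
  have he : 0 < (g - v)⁺ := lt_of_le_of_ne (posPart_nonneg _) fun h =>
    hgv (sub_nonpos.1 (posPart_eq_zero.1 h.symm))
  have heg : (g - v)⁺ ≤ g := sup_le (sub_le_self _ hv) hg.le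
  obtain ⟨S, heS, hSpos, hSinf, hSmax⟩ := exists_maximal_infClosed_pos he
  let G : Filter F :=
    { sets := {B | ∃ u ∈ S, notBelowSet g v u ⊆ B}
      univ_sets := ⟨_, heS, Set.subset_univ _⟩
      sets_of_superset := fun ⟨u, hu, h⟩ hBC => ⟨u, hu, h.trans hBC⟩
      inter_sets := fun ⟨u, hu, h⟩ ⟨u', hu', h'⟩ => ⟨u ⊓ u', hSinf hu hu', Set.subset_inter
        ((notBelowSet_mono g v inf_le_left).trans h)
        ((notBelowSet_mono g v inf_le_right).trans h')⟩ }
  refine ⟨G, ?_, ?_⟩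
  · rw [uoConvergesTo_iff]
    intro h hh
    refine ⟨{z | 0 ≤ z ∧ ∀ᶠ x in G, |x - 0| ⊓ h ≤ z}, fun z hz => hz.2, fun z hz => hz.1, ?_⟩
    intro w hw
    by_contra hw0
    have hwp : 0 < w⁺ := lt_of_le_of_ne (posPart_nonneg _) fun h => hw0 (posPart_eq_zero.1 h.symm)
    have hwle : ∀ z, 0 ≤ z → (∀ u ∈ S, (∀ x ∈ notBelowSet g v u, x ⊓ h ≤ z) → w⁺ ≤ z) := by
      intro z hz u hu hx
      refine sup_le (hw ⟨hz, u, hu, fun x hxu => ?_⟩) hz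
      rw [Set.mem_ofPred_eq, sub_zero, abs_of_nonneg hxu.1]
      exact hx x hxu
    have hwg : w⁺ ≤ g := hwle g hg.le _ heS fun x hx => inf_le_left.trans hx.2.1
    obtain ⟨p, q, hp, hq, hpw, hqw, hpq⟩ :=
      exists_disjoint_of_not_isVLAtom harch hwp fun h => hna _ h hwg
    obtain ⟨r, u, hr, hrw, hu, hru⟩ : ∃ r u : F, 0 < r ∧ r ≤ w⁺ ∧ u ∈ S ∧ u ⊓ r = 0 := by
      by_cases hall : ∀ u ∈ S, 0 < u ⊓ p
      · refine ⟨q, _, hq, hqw, hSmax p hall, ?_⟩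
        rw [inf_assoc, hpq]
        exact inf_eq_right.2 he.le
      · push Not at hall
        obtain ⟨u, hu, hup⟩ := hall
        have h0 : 0 ≤ u ⊓ p := le_inf (hSpos u hu).le hp.le
        exact ⟨p, u, hp, hpw, hu, by_contra fun h => hup (lt_of_le_of_ne h0 (Ne.symm h))⟩
    obtain ⟨n, hn, hn1⟩ := exists_nsmul_le_not_succ_nsmul_le harch hr hh
    have hle := hwle (h - n • r) (sub_nonneg.2 hn) u hu fun x hx => by
      obtain ⟨hx0, -, ⟨m, hm⟩, -⟩ := hx
      have hxh : 0 ≤ x ⊓ h := le_inf hx0 hh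
      have hrx : r ⊓ (x ⊓ h) = 0 := by
        refine le_antisymm ?_ (le_inf hr.le hxh)
        rw [← nsmul_inf_eq_zero (hSpos u hu).le hr.le hru m, inf_comm]
        exact inf_le_inf_right _ (inf_le_left.trans hm)
      exact le_sub_iff_add_le'.2
        (add_le_of_inf_eq_zero (nsmul_inf_eq_zero hr.le hxh hrx n) hn inf_le_right)
    refine hn1 ?_
    rw [succ_nsmul]
    exact le_sub_iff_add_le'.1 (hrw.trans hle)
  · rintro ⟨u, hu, hsub⟩
    have hmin : u ⊓ (g - v)⁺ ∈ S := hSinf hu heS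
    obtain ⟨x, hx⟩ := notBelowSet_nonempty harch hg.le hv (hSpos _ hmin) inf_le_right
    have hxv := hsub (notBelowSet_mono g v inf_le_left hx)
    rw [Set.mem_ofPred_eq, abs_of_nonneg hx.1, inf_eq_left.2 hx.2.1] at hxv
    exact hx.2.2.2 hxv

end VectorLattice

/-- An Archimedean vector lattice is atomic iff uo convergence on it is
topological. -/
theorem atomic_iff_uoConvergence_topological
    {F : Type*} [Lattice F] [AddCommGroup F] [Module ℝ F]
    (hadd : ∀ x y z : F, x ≤ y → x + z ≤ y + z)
    (hsmul : ∀ (t : ℝ) (x : F), 0 ≤ t → 0 ≤ x → 0 ≤ t • x)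
    (harch : ∀ x y : F, (∀ n : ℕ, 0 ≤ n • x ∧ n • x ≤ y) → x = 0) :
    (∀ g : F, 0 < g → ∃ a : F, IsVLAtom a ∧ a ≤ g) ↔
      (∃ τ : TopologicalSpace F, ∀ (G : Filter F) (f : F),
        UoConvergesTo G f ↔ G ≤ @nhds F τ f) := by
  have : IsOrderedAddMonoid F := { add_le_add_left := fun a b h c => hadd a b c h }
  have : IsOrderedModule ℝ F :=
    { smul_le_smul_of_nonneg_left := fun t ht x y hxy => by
        have h := hsmul t (y - x) ht (sub_nonneg.2 hxy)
        rwa [smul_sub, sub_nonneg] at h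
      smul_le_smul_of_nonneg_right := fun x hx s t hst => by
        have h := hsmul (t - s) x (sub_nonneg.2 hst) hx
        rwa [sub_smul, sub_nonneg] at h }
  constructor
  · intro hat
    choose τ hτ using fun a : {a : F // IsVLAtom a} => a.2.exists_topology
    refine ⟨⨅ a, τ a, fun G f => ?_⟩
    rw [nhds_iInf, le_iInf_iff, uoConvergesTo_iff_of_atomic harch hat]
    simp only [hτ, Subtype.forall]
  · rintro ⟨τ, hτ⟩ g hg
    by_contra! hna
    obtain ⟨V, hV, hglb⟩ := uoConvergesTo_iff.1 ((hτ (@nhds F τ 0) 0).2 le_rfl) g hg.le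
    obtain ⟨v, hv, hgv⟩ : ∃ v ∈ V, ¬ g ≤ v := by
      by_contra! hcon
      exact hg.not_ge (hglb.2 hcon)
    obtain ⟨G, hG, hGv⟩ :=
      exists_uoConvergesTo_zero_not_eventually_le harch hg hna (hglb.1 hv) hgv
    refine hGv (((hτ G 0).1 hG) ?_)
    have h := hV v hv
    simp only [sub_zero] at h
    exact h
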